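/- arXiv:math/0401402 — 2 statements merged into one kernel-verified Lean document; each statement's English description precedes it below -/
import Mathlib

section
/- Let Γ = α ∪ β be a finite index set partitioned into two disjoint nonempty subsets and A a complex matrix indexed by Γ such that the principal submatrix A_{β,β} is invertible. Then det A / det A_{β,β} = det B, where B is the matrix indexed by α with entries B_{kl} = det A_{β∪{k}, β∪{l}} / det A_{β,β}. -/
open Matrix

/-- Schur's determinant formula for a matrix sampled along rows `f, b` and columns `g, b`. -/
theorem det_submatrix_sumElim {R ι m n : Type*} [CommRing R] [Fintype m] [DecidableEq m]
    [Fintype n] [DecidableEq n] (A : Matrix ι ι R) (f g : m → ι) (b : n → ι)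
    (h : IsUnit (A.submatrix b b).det) :
    (A.submatrix (Sum.elim f b) (Sum.elim g b)).det =
      (A.submatrix b b).det *
        (A.submatrix f g - A.submatrix f b * (A.submatrix b b)⁻¹ * A.submatrix b g).det := by
  let _ := invertibleOfIsUnitDet _ h
  rw [← invOf_eq_nonsing_inv, ← det_fromBlocks₂₂]
  congr 1
  ext (i | i) (j | j) <;> rfl

/-- The determinant of a one-row, one-column border of an invertible submatrix. -/
theorem det_submatrix_optionElim {R ι n : Type*} [CommRing R] [Fintype n] [DecidableEq n]
    (A : Matrix ι ι R) (k l : ι) (b : n → ι) (h : IsUnit (A.submatrix b b).det) :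
    (A.submatrix (fun o : Option n => o.elim k b) (fun o : Option n => o.elim l b)).det =
      (A.submatrix b b).det *
        (A k l - (A.submatrix (fun _ : Unit => k) b * (A.submatrix b b)⁻¹ *
          A.submatrix b (fun _ : Unit => l)) () ()) := by
  let e : Unit ⊕ n ≃ Option n := (Equiv.sumComm _ _).trans (Equiv.optionEquivSumPUnit n).symm
  have hs := det_submatrix_sumElim A (fun _ : Unit => k) (fun _ : Unit => l) b h
  rw [det_unique (n := Unit)] at hs
  rw [← det_submatrix_equiv_self e, submatrix_submatrix]
  refine Eq.trans ?_ hs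
  congr 1
  ext (i | i) (j | j) <;> rfl

/-- The determinant ratio formula: if `Γ = α ∪ β` is a partition and `A_{β,β}` is
invertible, then `det A / det A_{β,β} = det B` where
`B_{kl} = det A_{β∪{k},β∪{l}} / det A_{β,β}` for `k, l ∈ α`. -/
theorem det_ratio_formula {Γ : Type*} [Fintype Γ] [DecidableEq Γ]
    (A : Matrix Γ Γ ℂ)
    (α β : Finset Γ) (hdisj : Disjoint α β) (hcover : α ∪ β = Finset.univ)
    (hα : α.Nonempty) (hβ : β.Nonempty)
    (hinv : IsUnit (A.submatrix (fun i : ↥β => (i : Γ)) (fun j : ↥β => (j : Γ))).det) :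
    A.det / (A.submatrix (fun i : ↥β => (i : Γ)) (fun j : ↥β => (j : Γ))).det =
      (Matrix.of fun k l : ↥α =>
        (A.submatrix (fun o : Option ↥β => o.elim (k : Γ) (fun i => (i : Γ)))
                     (fun o : Option ↥β => o.elim (l : Γ) (fun j => (j : Γ)))).det /
        (A.submatrix (fun i : ↥β => (i : Γ)) (fun j : ↥β => (j : Γ))).det).det := by
  let e : ↥α ⊕ ↥β ≃ Γ :=
    (Equiv.Finset.union α β hdisj).trans (Equiv.subtypeUnivEquiv fun x => by simp [hcover])
  have hdet : A.det = (A.submatrix (Sum.elim (fun i : ↥α => (i : Γ)) (fun i : ↥β => (i : Γ)))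
      (Sum.elim (fun i : ↥α => (i : Γ)) (fun i : ↥β => (i : Γ)))).det := by
    rw [← det_submatrix_equiv_self e]
    congr 1
    ext (i | i) (j | j) <;> rfl
  rw [hdet, det_submatrix_sumElim A _ _ _ hinv, mul_div_cancel_left₀ _ hinv.ne_zero]
  congr 1
  ext k l
  rw [of_apply, det_submatrix_optionElim A _ _ _ hinv, mul_div_cancel_left₀ _ hinv.ne_zero]
  rfl
end

section
/- Let T be a bounded positive invertible operator on a Hilbert space and P an orthogonal projection, P^⊥ = I − P. Set R := P(PTP)^{-1}P and S := P^⊥(P^⊥ T^{-1} P^⊥)^{-1} P^⊥ (inverses taken on the respective ranges). Then P T^{-1} P = R + P T^{-1} S T^{-1} P. -/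
/-- The Schur complement `P T' P - P T' S T' P` is a right inverse of `P T P` in the corner
cut out by an idempotent `P`, where `T'` is a right inverse of `T` and `S` inverts the
complementary corner of `T'`. -/
theorem corner_mul_schur_complement {A : Type*} [Ring A] {T T' P S : A}
    (hTT' : T * T' = 1) (hP : IsIdempotentElem P) (hPS : P * S = 0)
    (hS : (1 - P) * T' * S = 1 - P) :
    (P * T * P) * (P * T' * P - P * T' * S * T' * P) = P := by
  have hPP : P * P = P := hP
  have hcomp : P * T' * S = T' * S - (1 - P) := by
    rw [← hS]; noncomm_ring
  calc (P * T * P) * (P * T' * P - P * T' * S * T' * P)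
      = P * T * (P * P) * T' * P - P * T * (P * P) * T' * S * T' * P := by noncomm_ring
    _ = P * T * P * T' * P - P * T * (P * T' * S) * T' * P := by
        rw [hPP]; noncomm_ring
    _ = P * (T * T') * P - P * (T * T') * S * T' * P := by
        rw [hcomp]; noncomm_ring
    _ = P := by simp [hTT', hPP, hPS]


/-- Decomposition formula: for a bounded positive invertible operator `T` with inverse
`T'`, an orthogonal projection `P` with complement `P⊥ = 1 - P`,
`R := P (P T P)⁻¹ P` and `S := P⊥ (P⊥ T' P⊥)⁻¹ P⊥` (inverses on the respective ranges,
extended by zero), one has `P T⁻¹ P = R + P T⁻¹ S T⁻¹ P`. -/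
theorem projection_inversion_decomposition {H : Type*} [NormedAddCommGroup H]
    [InnerProductSpace ℂ H] [CompleteSpace H]
    (T T' : H →L[ℂ] H) (hT : T.IsPositive)
    (hTT' : T * T' = 1) (hT'T : T' * T = 1)
    (P : H →L[ℂ] H) (hP : IsIdempotentElem P) (hPsa : IsSelfAdjoint P)
    (R S : H →L[ℂ] H)
    (hRP : P * R * P = R)
    (hR1 : (P * T * P) * R = P) (hR2 : R * (P * T * P) = P)
    (hSP : (1 - P) * S * (1 - P) = S)
    (hS1 : ((1 - P) * T' * (1 - P)) * S = 1 - P)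
    (hS2 : S * ((1 - P) * T' * (1 - P)) = 1 - P) :
    P * T' * P = R + P * T' * S * T' * P := by
  have hPP : P * P = P := hP
  have hPQ : P * (1 - P) = 0 := by rw [mul_sub, mul_one, hPP, sub_self]
  have hPS : P * S = 0 := by
    rw [← hSP, ← mul_assoc, ← mul_assoc, hPQ, zero_mul, zero_mul]
  have hQS : (1 - P) * S = S := by rw [sub_mul, one_mul, hPS, sub_zero]
  have hS : (1 - P) * T' * S = 1 - P := by rwa [mul_assoc _ (1 - P) S, hQS] at hS1
  have hRP' : R * P = R := by rw [← hRP, mul_assoc, hPP]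
  have key : P * (P * T' * P - P * T' * S * T' * P) = R := by
    calc P * (P * T' * P - P * T' * S * T' * P)
        = R * ((P * T * P) * (P * T' * P - P * T' * S * T' * P)) := by rw [← mul_assoc R, hR2]
      _ = R := by rw [corner_mul_schur_complement hTT' hP hPS hS, hRP']
  rw [mul_sub] at key
  simp only [← mul_assoc, hPP] at key
  rw [← key, sub_add_cancel]
end
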